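/- Let λ > 0, let 0 < r_1 < r_2 < r_3 be real numbers, set r_0 = −(r_1 + r_2 + r_3), and define Δ(r) = −λ(r − r_0)(r − r_1)(r − r_2)(r − r_3) with derivative Δ'. Let a, k_t, k_φ be real numbers and let r satisfy r_2 < r < r_3. Suppose that Δ'(r) > 0, that k_t < 0, that the trapping condition 4 r Δ(r) k_t = ((r² + a²) k_t + a k_φ) Δ'(r) holds, and that (r_2² + a²) k_t + a k_φ ≥ 0 or (r_3² + a²) k_t + a k_φ ≥ 0. Then a contradiction follows; i.e., no such data exist. -/

import Mathlib

/-- Derivative of a quartic given in factored form. -/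
theorem hasDerivAt_factored_quartic (c r₀ r₁ r₂ r₃ r : ℝ) :
    HasDerivAt (fun x => c * (x - r₀) * (x - r₁) * (x - r₂) * (x - r₃))
      (c * ((r - r₁) * (r - r₂) * (r - r₃) + (r - r₀) * (r - r₂) * (r - r₃)
        + (r - r₀) * (r - r₁) * (r - r₃) + (r - r₀) * (r - r₁) * (r - r₂))) r := by
  have h (s : ℝ) : HasDerivAt (fun x : ℝ => x - s) 1 r := (hasDerivAt_id r).sub_const s
  refine (((((h r₀).const_mul c).mul (h r₁)).mul (h r₂)).mul (h r₃)).congr_deriv ?_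
  simp only [Pi.mul_apply]
  ring

/-- For positive factors `u₀, u₁, u₂, u₃` and `w < u₀`, `u₂ < u₁`, the logarithmic derivative
`1/u₀ + 1/u₁ + 1/u₂ - 1/u₃` is below `2/u₂ + 2/w`, written without denominators. -/
theorem mul_deriv_factors_lt {u₀ u₁ u₂ u₃ w : ℝ} (hu₂ : 0 < u₂) (hu₃ : 0 < u₃) (hw : 0 < w)
    (hwu : w < u₀) (hu : u₂ < u₁) :
    w * (u₁ * u₂ * u₃ + u₀ * u₂ * u₃ + u₀ * u₁ * u₃ - u₀ * u₁ * u₂)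
      < 2 * (u₂ + w) * (u₀ * u₁ * u₃) := by
  have hu₀ : 0 < u₀ := hw.trans hwu
  have hu₁ : 0 < u₁ := hu₂.trans hu
  have e₁ : 0 < (u₀ - w) * (u₁ * u₂ * u₃) := mul_pos (sub_pos.2 hwu) (by positivity)
  have e₂ : 0 < (u₁ - u₂) * (u₀ * u₃ * w) := mul_pos (sub_pos.2 hu) (by positivity)
  have e₃ : 0 < w * (u₀ * u₁ * u₂) := by positivity
  have e₄ : 0 < u₀ * u₁ * u₂ * u₃ := by positivity
  linarith

/-- In subextreme Kerr–de Sitter (`λ > 0`, roots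
`r₀ = -(r₁+r₂+r₃) `, `0 < r₁ < r₂ < r₃` of `Δ`), no trapped null covector
with `Δ'(r) > 0`, `k_t < 0`, the trapping condition
`4rΔ(r)k_t = ((r²+a²)k_t + a k_φ)Δ'(r)`, and `k(v_+) ≥ 0` or `k(v_c) ≥ 0`
can exist: the assumptions are contradictory. -/
theorem stmt_1 (lam r₁ r₂ r₃ : ℝ) (hlam : 0 < lam)
    (h₁ : 0 < r₁) (h₁₂ : r₁ < r₂) (h₂₃ : r₂ < r₃)
    (r₀ : ℝ) (hr₀ : r₀ = -(r₁ + r₂ + r₃))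
    (Δ : ℝ → ℝ)
    (hΔ : ∀ r, Δ r = -lam * (r - r₀) * (r - r₁) * (r - r₂) * (r - r₃))
    (a kt kφ r : ℝ) (hr₂ : r₂ < r) (hr₃ : r < r₃)
    (hΔ' : 0 < deriv Δ r) (hkt : kt < 0)
    (htrap : 4 * r * Δ r * kt = ((r ^ 2 + a ^ 2) * kt + a * kφ) * deriv Δ r)
    (hv : 0 ≤ (r₂ ^ 2 + a ^ 2) * kt + a * kφ ∨ 0 ≤ (r₃ ^ 2 + a ^ 2) * kt + a * kφ) :
    False := by
  have hderiv : deriv Δ r = -lam * ((r - r₁) * (r - r₂) * (r - r₃)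
      + (r - r₀) * (r - r₂) * (r - r₃) + (r - r₀) * (r - r₁) * (r - r₃)
      + (r - r₀) * (r - r₁) * (r - r₂)) := by
    rw [funext hΔ]
    exact (hasDerivAt_factored_quartic (-lam) r₀ r₁ r₂ r₃ r).deriv
  have hlt : (r ^ 2 - r₂ ^ 2) * deriv Δ r < 4 * r * Δ r := by
    have key := mul_lt_mul_of_pos_left
      (mul_deriv_factors_lt (u₀ := r - r₀) (u₁ := r - r₁) (u₂ := r - r₂) (u₃ := r₃ - r)
        (w := r + r₂) (by linarith) (by linarith) (by linarith) (by linarith) (by linarith))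
      (mul_pos hlam (sub_pos.2 hr₂))
    rw [hderiv, hΔ r]
    linarith
  have hv₂ : 0 ≤ (r₂ ^ 2 + a ^ 2) * kt + a * kφ := by
    rcases hv with hv | hv
    · exact hv
    · have hsq : r₂ ^ 2 ≤ r₃ ^ 2 := by gcongr; linarith
      linarith [mul_le_mul_of_nonpos_right hsq hkt.le]
  have hneg := mul_lt_mul_of_neg_right hlt hkt
  have hnonneg := mul_nonneg hv₂ hΔ'.le
  linarith
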